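/- For every ν < 0, the function x ↦ H_{ν−1}(x)² / (H_ν(x) · H_{ν−2}(x)) is strictly decreasing on ℝ and takes values strictly between 1 and (ν−1)/ν. -/

import Mathlib

open MeasureTheory Real Filter

noncomputable def G (ν x : ℝ) : ℝ :=
  ∫ t in Set.Ioi (0:ℝ), t ^ (-ν - 1) * Real.exp (-t^2/2 - x*t)

noncomputable def D (ν x : ℝ) : ℝ :=
  Real.exp (-x^2/4) / Real.Gamma (-ν) * G ν x

noncomputable def H (ν x : ℝ) : ℝ :=
  (2:ℝ) ^ (ν / 2) * Real.exp (x^2 / 2) * D ν (x * Real.sqrt 2)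

open Topology

/-- The moments `∫₀^∞ t^(s-1) exp(-t²/2 - yt) dt`. -/
noncomputable def gaussMoment (s y : ℝ) : ℝ :=
  ∫ t in Set.Ioi (0:ℝ), t ^ (s - 1) * Real.exp (-t^2/2 - y*t)

namespace gaussMoment

variable {s : ℝ}

lemma integrableOn (hs : 0 < s) (y : ℝ) :
    IntegrableOn (fun t : ℝ => t ^ (s - 1) * Real.exp (-t^2/2 - y*t)) (Set.Ioi 0) := by
  have h := (integrableOn_rpow_mul_exp_neg_mul_sq (b := 1/4) (by norm_num)
    (s := s - 1) (by linarith)).const_mul (Real.exp (y^2))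
  refine Integrable.mono' h (by fun_prop) ?_
  filter_upwards [ae_restrict_mem measurableSet_Ioi] with t ht
  have ht' : 0 ≤ t ^ (s - 1) := Real.rpow_nonneg (le_of_lt ht) _
  rw [Real.norm_of_nonneg (by positivity)]
  calc t ^ (s - 1) * Real.exp (-t^2/2 - y*t)
      ≤ t ^ (s - 1) * Real.exp (y^2 + -(1/4) * t^2) := by
        gcongr
        nlinarith [sq_nonneg (t/2 + y)]
    _ = _ := by rw [Real.exp_add]; ring

lemma rpow_mul {t : ℝ} (ht : 0 < t) (s : ℝ) : t ^ (s + 1 - 1) = t ^ (s - 1) * t := by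
  rw [← Real.rpow_add_one ht.ne']
  congr 1
  ring

lemma hasDerivAt (hs : 0 < s) (y : ℝ) :
    HasDerivAt (gaussMoment s) (-gaussMoment (s + 1) y) y := by
  have key := hasDerivAt_integral_of_dominated_loc_of_deriv_le
    (μ := volume.restrict (Set.Ioi (0:ℝ)))
    (F := fun y t => t ^ (s - 1) * Real.exp (-t^2/2 - y*t))
    (F' := fun y t => -(t ^ (s + 1 - 1) * Real.exp (-t^2/2 - y*t)))
    (bound := fun t => t ^ (s + 1 - 1) * Real.exp (-t^2/2 - (y - 1)*t))
    (s := Metric.ball y 1) (x₀ := y) (Metric.ball_mem_nhds y one_pos)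
    (Eventually.of_forall fun _ => by fun_prop) (integrableOn hs y) (by fun_prop) ?_
    (integrableOn (by linarith) _) ?_
  · have h := key.2
    rw [integral_neg] at h
    exact h
  · filter_upwards [ae_restrict_mem measurableSet_Ioi] with t ht x hx
    have ht0 : 0 < t := ht
    rw [norm_neg, Real.norm_of_nonneg (by positivity)]
    rw [Metric.mem_ball, Real.dist_eq, abs_lt] at hx
    gcongr
    linarith [hx.1]
  · filter_upwards [ae_restrict_mem measurableSet_Ioi] with t ht x _
    have h1 : HasDerivAt (fun y : ℝ => -t^2/2 - y*t) (-(1*t)) x :=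
      ((hasDerivAt_id x).mul_const t).const_sub _
    have h2 := h1.exp.const_mul (t ^ (s - 1))
    rw [rpow_mul ht]
    exact h2.congr_deriv (by ring)

lemma integral_pos_of_pos_off {f : ℝ → ℝ} (c : ℝ) (hf : IntegrableOn f (Set.Ioi 0))
    (h0 : ∀ t, 0 < t → 0 ≤ f t) (h : ∀ t, 0 < t → t ≠ c → 0 < f t) :
    0 < ∫ t in Set.Ioi (0:ℝ), f t := by
  rw [setIntegral_pos_iff_support_of_nonneg_ae _ hf]
  · refine lt_of_lt_of_le ?_ (measure_mono (s := Set.Ioo |c| (|c| + 1)) ?_)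
    · simp
    · intro t ht
      have h1 : 0 < t := (abs_nonneg c).trans_lt ht.1
      exact ⟨(h t h1 ((le_abs_self c).trans_lt ht.1).ne').ne', h1⟩
  · filter_upwards [ae_restrict_mem measurableSet_Ioi] with t ht
    exact h0 t ht

lemma pos (hs : 0 < s) (y : ℝ) : 0 < gaussMoment s y := by
  have h : ∀ t : ℝ, 0 < t → 0 < t ^ (s - 1) * Real.exp (-t^2/2 - y*t) :=
    fun t ht => by positivity
  exact integral_pos_of_pos_off 0 (integrableOn hs y) (fun t ht => (h t ht).le)
    fun t ht _ => h t ht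

/-- The strict Cauchy–Schwarz inequality for consecutive moments. -/
lemma sq_lt_mul (hs : 0 < s) (y : ℝ) :
    gaussMoment (s + 1) y ^ 2 < gaussMoment s y * gaussMoment (s + 1 + 1) y := by
  have hp := pos hs y
  set c := gaussMoment (s + 1) y / gaussMoment s y with hc
  have i0 := integrableOn hs y
  have i1 := integrableOn (s := s + 1) (by linarith) y
  have i2 := integrableOn (s := s + 1 + 1) (by linarith) y
  have hE : ∫ t in Set.Ioi (0:ℝ), (t ^ (s + 1 + 1 - 1) * Real.exp (-t^2/2 - y*t)
      - 2 * c * (t ^ (s + 1 - 1) * Real.exp (-t^2/2 - y*t))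
      + c ^ 2 * (t ^ (s - 1) * Real.exp (-t^2/2 - y*t)))
      = gaussMoment (s + 1 + 1) y - 2 * c * gaussMoment (s + 1) y + c ^ 2 * gaussMoment s y := by
    have i21 : IntegrableOn (fun t : ℝ => t ^ (s + 1 + 1 - 1) * Real.exp (-t^2/2 - y*t)
        - 2 * c * (t ^ (s + 1 - 1) * Real.exp (-t^2/2 - y*t))) (Set.Ioi 0) :=
      i2.sub (i1.const_mul _)
    rw [integral_add i21 (i0.const_mul _), integral_sub i2 (i1.const_mul _), integral_const_mul, integral_const_mul]
    rfl
  have hsq : ∀ t : ℝ, 0 < t → t ^ (s + 1 + 1 - 1) * Real.exp (-t^2/2 - y*t)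
      - 2 * c * (t ^ (s + 1 - 1) * Real.exp (-t^2/2 - y*t))
      + c ^ 2 * (t ^ (s - 1) * Real.exp (-t^2/2 - y*t))
      = t ^ (s - 1) * Real.exp (-t^2/2 - y*t) * (t - c) ^ 2 := by
    intro t ht
    rw [rpow_mul ht (s + 1), rpow_mul ht s]
    ring
  have hpos := integral_pos_of_pos_off c ((i2.sub (i1.const_mul (2 * c))).add
    (i0.const_mul (c ^ 2))) (fun t ht => by
      simp only [Pi.add_apply, Pi.sub_apply]
      rw [hsq t ht]; positivity) (fun t ht htc => by
      simp only [Pi.add_apply, Pi.sub_apply]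
      rw [hsq t ht]
      have := sub_ne_zero.2 htc
      positivity)
  have hpos' := hpos.trans_eq hE
  have hcm : c * gaussMoment s y = gaussMoment (s + 1) y := by
    rw [hc]; field_simp
  rw [← hcm] at hpos' ⊢
  nlinarith [mul_pos hpos' hp]

/-- Integration by parts. -/
lemma mul_eq (hs : 0 < s) (y : ℝ) :
    s * gaussMoment s y = gaussMoment (s + 1 + 1) y + y * gaussMoment (s + 1) y := by
  have i0 := integrableOn hs y
  have i1 := integrableOn (s := s + 1) (by linarith) y
  have i2 := integrableOn (s := s + 1 + 1) (by linarith) y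
  have hd : ∀ t ∈ Set.Ioi (0:ℝ), HasDerivAt
      (fun t : ℝ => t ^ (s + 1 - 1) * Real.exp (-t^2/2 - y*t))
      (s * (t ^ (s - 1) * Real.exp (-t^2/2 - y*t))
        - t ^ (s + 1 + 1 - 1) * Real.exp (-t^2/2 - y*t)
        - y * (t ^ (s + 1 - 1) * Real.exp (-t^2/2 - y*t))) t := by
    intro t ht
    have ht0 : 0 < t := ht
    have h1 : HasDerivAt (fun t : ℝ => -t^2/2 - y*t) (-t - y) t := by
      have h := (((hasDerivAt_id t).pow 2).neg.div_const 2).sub ((hasDerivAt_id t).const_mul y)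
      exact h.congr_deriv (by simp; ring)
    have h2 := Real.hasDerivAt_rpow_const (x := t) (p := s + 1 - 1) (Or.inl ht0.ne')
    refine (h2.mul h1.exp).congr_deriv ?_
    rw [rpow_mul ht0 (s + 1), show s + 1 - 1 = s by ring]
    ring
  have i02 : IntegrableOn (fun t : ℝ => s * (t ^ (s - 1) * Real.exp (-t^2/2 - y*t))
      - t ^ (s + 1 + 1 - 1) * Real.exp (-t^2/2 - y*t)) (Set.Ioi 0) :=
    (i0.const_mul s).sub i2
  have hint := i02.sub (i1.const_mul y)
  have hlim := tendsto_zero_of_hasDerivAt_of_integrableOn_Ioi hd hint i1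
  have hcont : ContinuousWithinAt (fun t : ℝ => t ^ (s + 1 - 1) * Real.exp (-t^2/2 - y*t))
      (Set.Ici 0) 0 := by
    refine ContinuousAt.continuousWithinAt (ContinuousAt.mul ?_ (by fun_prop))
    exact Real.continuousAt_rpow_const _ _ (Or.inr (by linarith))
  have h := integral_Ioi_of_hasDerivAt_of_tendsto hcont hd hint hlim
  rw [integral_sub i02 (i1.const_mul y), integral_sub (i0.const_mul s) i2,
    integral_const_mul, integral_const_mul, Real.zero_rpow (by linarith)] at h
  simp only [zero_mul, sub_zero] at h
  unfold gaussMoment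
  linarith

end gaussMoment

/-- The ratio of consecutive moments. -/
noncomputable def momentRatio (s y : ℝ) : ℝ := gaussMoment (s + 1) y / gaussMoment s y

namespace momentRatio

variable {s : ℝ}

lemma pos (hs : 0 < s) (y : ℝ) : 0 < momentRatio s y :=
  div_pos (gaussMoment.pos (by linarith) y) (gaussMoment.pos hs y)

lemma lt_succ (hs : 0 < s) (y : ℝ) : momentRatio s y < momentRatio (s + 1) y := by
  unfold momentRatio
  rw [div_lt_div_iff₀ (gaussMoment.pos hs y) (gaussMoment.pos (by linarith) y)]
  linarith [gaussMoment.sq_lt_mul hs y]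

lemma mul_succ_add (hs : 0 < s) (y : ℝ) :
    momentRatio s y * (momentRatio (s + 1) y + y) = s := by
  have h0 := gaussMoment.pos hs y
  have h1 := gaussMoment.pos (s := s + 1) (by linarith) y
  have h := gaussMoment.mul_eq hs y
  unfold momentRatio
  field_simp
  linarith

lemma hasDerivAt (hs : 0 < s) (y : ℝ) :
    HasDerivAt (momentRatio s) (momentRatio s y * (momentRatio s y - momentRatio (s + 1) y)) y := by
  have h0 := gaussMoment.pos hs y
  have h1 := gaussMoment.pos (s := s + 1) (by linarith) y
  refine ((gaussMoment.hasDerivAt (s := s + 1) (by linarith) y).div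
    (gaussMoment.hasDerivAt hs y) h0.ne').congr_deriv ?_
  unfold momentRatio
  field_simp
  ring

lemma lt_div (hs : 0 < s) {y : ℝ} (hy : 0 < y) : momentRatio s y < s / y := by
  rw [lt_div_iff₀ hy]
  nlinarith [mul_succ_add hs y, mul_pos (pos hs y) (pos (s := s + 1) (by linarith) y)]

lemma tendsto_zero (hs : 0 < s) : Tendsto (momentRatio s) atTop (𝓝 0) := by
  refine tendsto_of_tendsto_of_tendsto_of_le_of_le' tendsto_const_nhds
    (tendsto_id.const_div_atTop s) (Eventually.of_forall fun y => (pos hs y).le) ?_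
  filter_upwards [eventually_gt_atTop 0] with y hy using (lt_div hs hy).le

lemma div_succ_identity (hs : 0 < s) (y : ℝ) :
    momentRatio s y / momentRatio (s + 1) y = s / (s + 1) +
      momentRatio s y * (momentRatio (s + 1 + 1) y - momentRatio (s + 1) y) / (s + 1) := by
  have h0 := mul_succ_add hs y
  have h1 := mul_succ_add (s := s + 1) (by linarith) y
  have hv := pos (s := s + 1) (by linarith) y
  have : s + 1 ≠ 0 := by linarith
  field_simp
  linear_combination momentRatio (s + 1) y * h0 - momentRatio s y * h1

lemma div_succ_gt (hs : 0 < s) (y : ℝ) :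
    s / (s + 1) < momentRatio s y / momentRatio (s + 1) y := by
  rw [div_succ_identity hs, lt_add_iff_pos_right]
  have h1 := sub_pos.2 (lt_succ (s := s + 1) (by linarith) y)
  have h0 := pos hs y
  positivity

lemma div_succ_lt_one (hs : 0 < s) (y : ℝ) :
    momentRatio s y / momentRatio (s + 1) y < 1 :=
  (div_lt_one (pos (by linarith) y)).2 (lt_succ hs y)

lemma div_succ_tendsto (hs : 0 < s) :
    Tendsto (fun y => momentRatio s y / momentRatio (s + 1) y) atTop (𝓝 (s / (s + 1))) := by
  simp_rw [div_succ_identity hs]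
  have h := (((tendsto_zero hs).mul ((tendsto_zero (s := s + 1 + 1) (by linarith)).sub
    (tendsto_zero (s := s + 1) (by linarith)))).div_const (s + 1)).const_add (s / (s + 1))
  simpa using h

lemma hasDerivAt_div_succ (hs : 0 < s) (y : ℝ) :
    HasDerivAt (fun y => momentRatio s y / momentRatio (s + 1) y)
      (momentRatio s y / momentRatio (s + 1) y *
        (momentRatio s y - 2 * momentRatio (s + 1) y + momentRatio (s + 1 + 1) y)) y := by
  have hv := pos (s := s + 1) (by linarith) y
  refine ((hasDerivAt hs y).div (hasDerivAt (s := s + 1) (by linarith) y) hv.ne').congr_deriv ?_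
  field_simp
  ring

/-- The second difference of the ratios has positive derivative wherever it vanishes, so once
nonnegative it stays so; this contradicts the limit of `momentRatio s / momentRatio (s + 1)`. -/
lemma second_difference_neg (hs : 0 < s) (y : ℝ) :
    momentRatio s y - 2 * momentRatio (s + 1) y + momentRatio (s + 1 + 1) y < 0 := by
  by_contra! hy
  set L : ℝ → ℝ := fun y =>
    momentRatio s y - 2 * momentRatio (s + 1) y + momentRatio (s + 1 + 1) y with hL
  have hd : ∀ x, HasDerivAt L _ x := fun x =>
    ((hasDerivAt hs x).sub ((hasDerivAt (s := s + 1) (by linarith) x).const_mul 2)).add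
      (hasDerivAt (s := s + 1 + 1) (by linarith) x)
  have hLnn : ∀ x, y ≤ x → 0 ≤ L x := by
    intro b hb
    have h := image_le_of_deriv_right_lt_deriv_boundary (f := fun x => -L x) (a := y) (b := b)
      (B := fun _ => 0) (B' := fun _ => 0)
      (fun x _ => (hd x).neg.continuousAt.continuousWithinAt)
      (fun x _ => (hd x).neg.hasDerivWithinAt) (by simpa using hy)
      (fun x => hasDerivAt_const x 0) ?_ (Set.right_mem_Icc.2 hb)
    · simpa using h
    · intro x _ hx
      have h0 : L x = 0 := by simpa using hx
      simp only [hL] at h0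
      have hlt := lt_succ hs x
      have e1 := mul_succ_add (s := s + 1) (by linarith) x
      have e2 := mul_succ_add (s := s + 1 + 1) (by linarith) x
      have e0 := mul_succ_add hs x
      set u := momentRatio s x
      set v := momentRatio (s + 1) x
      set w := momentRatio (s + 1 + 1) x
      set z := momentRatio (s + 1 + 1 + 1) x
      have hw : w = 2 * v - u := by linarith
      rw [hw] at e1 e2 ⊢
      nlinarith [mul_pos (sub_pos.2 hlt) (sub_pos.2 hlt)]
  have hmono : MonotoneOn (fun y => momentRatio s y / momentRatio (s + 1) y) (Set.Ici y) := by
    refine monotoneOn_of_deriv_nonneg (convex_Ici y)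
      (fun x _ => (hasDerivAt_div_succ hs x).continuousAt.continuousWithinAt)
      (fun x _ => (hasDerivAt_div_succ hs x).differentiableAt.differentiableWithinAt) ?_
    intro x hx
    rw [interior_Ici] at hx
    rw [(hasDerivAt_div_succ hs x).deriv]
    exact mul_nonneg (div_pos (pos hs x) (pos (by linarith) x)).le (hLnn x hx.le)
  refine absurd (div_succ_gt hs y) (not_lt.2 (ge_of_tendsto (div_succ_tendsto hs) ?_))
  filter_upwards [eventually_ge_atTop y] with x hx using hmono Set.self_mem_Ici hx hx

lemma div_succ_strictAnti (hs : 0 < s) :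
    StrictAnti (fun y => momentRatio s y / momentRatio (s + 1) y) := by
  refine strictAnti_of_deriv_neg fun y => ?_
  rw [(hasDerivAt_div_succ hs y).deriv]
  exact mul_neg_of_pos_of_neg (div_pos (pos hs y) (pos (by linarith) y))
    (second_difference_neg hs y)

end momentRatio

lemma H_eq_gaussMoment (ν x : ℝ) :
    H ν x = (2:ℝ) ^ (ν / 2) / Real.Gamma (-ν) * gaussMoment (-ν) (x * Real.sqrt 2) := by
  have h : Real.exp (x^2 / 2) * Real.exp (-(x * Real.sqrt 2)^2 / 4) = 1 := by
    rw [← Real.exp_add, mul_pow, Real.sq_sqrt (by norm_num), Real.exp_eq_one_iff]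
    ring
  simp only [H, D, G, gaussMoment]
  linear_combination ((2:ℝ) ^ (ν / 2) / Real.Gamma (-ν) * ∫ t in Set.Ioi (0:ℝ),
    t ^ (-ν - 1) * Real.exp (-t^2/2 - (x * Real.sqrt 2)*t)) * h

lemma H_ratio_eq {ν : ℝ} (hν : ν < 0) (x : ℝ) :
    (H (ν - 1) x) ^ 2 / (H ν x * H (ν - 2) x) = (ν - 1) / ν *
      (momentRatio (-ν) (x * Real.sqrt 2) / momentRatio (-ν + 1) (x * Real.sqrt 2)) := by
  have hs : 0 < -ν := by linarith
  have h2 : ((2:ℝ) ^ ((ν - 1) / 2)) ^ 2 = 2 ^ (ν / 2) * 2 ^ ((ν - 2) / 2) := by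
    rw [← Real.rpow_natCast, ← Real.rpow_mul (by norm_num), ← Real.rpow_add (by norm_num)]
    congr 1
    push_cast
    ring
  rw [H_eq_gaussMoment, H_eq_gaussMoment, H_eq_gaussMoment,
    show -(ν - 1) = -ν + 1 by ring, show -(ν - 2) = -ν + 1 + 1 by ring,
    Real.Gamma_add_one (s := -ν + 1) (by linarith), Real.Gamma_add_one hs.ne']
  have m0 := gaussMoment.pos hs (x * Real.sqrt 2)
  have m1 := gaussMoment.pos (s := -ν + 1) (by linarith) (x * Real.sqrt 2)
  have m2 := gaussMoment.pos (s := -ν + 1 + 1) (by linarith) (x * Real.sqrt 2)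
  have hg := Real.Gamma_pos_of_pos hs
  have p0 : (0:ℝ) < 2 ^ (ν / 2) := by positivity
  have p2 : (0:ℝ) < 2 ^ ((ν - 2) / 2) := by positivity
  have hν1 : -ν + 1 ≠ 0 := by linarith
  rw [mul_pow, div_pow, h2]
  unfold momentRatio
  generalize (2:ℝ) ^ (ν / 2) = A at *
  generalize (2:ℝ) ^ ((ν - 2) / 2) = B at *
  have hν0 := hν.ne
  field_simp
  ring

theorem stmt18 (ν : ℝ) (hν : ν < 0) :
    StrictAnti (fun x : ℝ => (H (ν - 1) x) ^ 2 / (H ν x * H (ν - 2) x)) ∧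
      ∀ x : ℝ, 1 < (H (ν - 1) x) ^ 2 / (H ν x * H (ν - 2) x) ∧
        (H (ν - 1) x) ^ 2 / (H ν x * H (ν - 2) x) < (ν - 1) / ν := by
  have hs : 0 < -ν := by linarith
  have hc : 0 < (ν - 1) / ν := div_pos_of_neg_of_neg (by linarith) hν
  simp_rw [H_ratio_eq hν]
  refine ⟨fun x y hxy => ?_, fun x => ⟨?_, ?_⟩⟩
  · exact mul_lt_mul_of_pos_left (momentRatio.div_succ_strictAnti hs
      (mul_lt_mul_of_pos_right hxy (by positivity))) hc
  · calc (1:ℝ) = (ν - 1) / ν * (-ν / (-ν + 1)) := by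
          have h1 : -ν + 1 ≠ 0 := by linarith
          have h0 := hν.ne
          field_simp
          ring
      _ < _ := mul_lt_mul_of_pos_left (momentRatio.div_succ_gt hs _) hc
  · exact mul_lt_of_lt_one_right hc (momentRatio.div_succ_lt_one hs _)
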